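/- (Well-posedness of implied volatility.) For all S, K, τ > 0, r, δ ∈ ℝ, and every price π with max(S e^{-δτ} − K e^{-rτ}, 0) < π < S e^{-δτ}, there exists a unique σ > 0 such that C(S, σ, r, δ, K, τ) = π. -/

import Mathlib

open Real Filter Set

/-- Standard normal CDF. -/
noncomputable def stdNormalCDF (x : ℝ) : ℝ :=
  (Real.sqrt (2 * Real.pi))⁻¹ * ∫ t in Set.Iic x, Real.exp (-t ^ 2 / 2)

/-- Standard normal density. -/
noncomputable def stdNormalPDF (x : ℝ) : ℝ :=
  (Real.sqrt (2 * Real.pi))⁻¹ * Real.exp (-x ^ 2 / 2)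

/-- d₊ in the Black–Scholes formula. -/
noncomputable def dPlus (S σ r δ K τ : ℝ) : ℝ :=
  (Real.log (S / K) + (r - δ) * τ) / (σ * Real.sqrt τ) + σ * Real.sqrt τ / 2

/-- d₋ in the Black–Scholes formula. -/
noncomputable def dMinus (S σ r δ K τ : ℝ) : ℝ :=
  (Real.log (S / K) + (r - δ) * τ) / (σ * Real.sqrt τ) - σ * Real.sqrt τ / 2

/-- Black–Scholes call price. -/
noncomputable def bsCall (S σ r δ K τ : ℝ) : ℝ :=
  S * Real.exp (-δ * τ) * stdNormalCDF (dPlus S σ r δ K τ)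
    - K * Real.exp (-r * τ) * stdNormalCDF (dMinus S σ r δ K τ)

open MeasureTheory ProbabilityTheory Topology

theorem aux_integrable : Integrable (fun t : ℝ => Real.exp (-t ^ 2 / 2)) := by
  have := integrable_exp_neg_mul_sq (b := 1 / 2) (by norm_num)
  refine this.congr (ae_of_all _ fun t => ?_)
  show Real.exp _ = Real.exp _
  congr 1; ring

theorem aux_cdf : stdNormalCDF = fun x => cdf (gaussianReal 0 1) x := by
  funext x
  rw [cdf_eq_real, measureReal_def, gaussianReal_apply_eq_integral _ (by norm_num),
    ENNReal.toReal_ofReal (integral_nonneg fun t => gaussianPDFReal_nonneg _ _ _)]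
  simp [stdNormalCDF, gaussianPDFReal_def, integral_const_mul]

theorem aux_top : Tendsto stdNormalCDF atTop (𝓝 1) := by
  rw [aux_cdf]; exact tendsto_cdf_atTop _

theorem aux_bot : Tendsto stdNormalCDF atBot (𝓝 0) := by
  rw [aux_cdf]; exact tendsto_cdf_atBot _

theorem aux_deriv (x : ℝ) : HasDerivAt stdNormalCDF (stdNormalPDF x) x := by
  have hc : Continuous (fun t : ℝ => Real.exp (-t ^ 2 / 2)) := by fun_prop
  have h1 : stdNormalCDF = fun x => (Real.sqrt (2 * Real.pi))⁻¹ *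
      ((∫ t in Set.Iic (0:ℝ), Real.exp (-t ^ 2 / 2)) + ∫ t in (0:ℝ)..x, Real.exp (-t ^ 2 / 2)) := by
    funext y
    rw [← intervalIntegral.integral_Iic_sub_Iic aux_integrable.integrableOn
      aux_integrable.integrableOn]
    simp [stdNormalCDF]
  rw [h1]
  have h2 := (hc.integral_hasStrictDerivAt 0 x).hasDerivAt
  exact (h2.const_add _).const_mul _

theorem aux_fderiv (A B m v : ℝ) (hv : 0 < v) (hAB : A = B * Real.exp m) :
    HasDerivAt (fun v => A * stdNormalCDF (m / v + v / 2) - B * stdNormalCDF (m / v - v / 2))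
      (A * stdNormalPDF (m / v + v / 2)) v := by
  have hi : HasDerivAt (fun v : ℝ => m / v) (-m / v ^ 2) v := by
    have := (hasDerivAt_inv hv.ne').const_mul m
    simp only [div_eq_mul_inv]
    exact this.congr_deriv (by ring)
  have hh : HasDerivAt (fun v : ℝ => v / 2) (1 / 2) v := (hasDerivAt_id v).div_const 2
  have h1 := ((aux_deriv (m / v + v / 2)).comp v (hi.add hh)).const_mul A
  have h2 := ((aux_deriv (m / v - v / 2)).comp v (hi.sub hh)).const_mul B
  have key : B * stdNormalPDF (m / v - v / 2) = A * stdNormalPDF (m / v + v / 2) := by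
    have : Real.exp (-(m / v - v / 2) ^ 2 / 2) =
        Real.exp m * Real.exp (-(m / v + v / 2) ^ 2 / 2) := by
      rw [← Real.exp_add]; congr 1; field_simp; ring
    rw [hAB, stdNormalPDF, stdNormalPDF, this]; ring
  refine (h1.sub h2).congr_deriv ?_
  linear_combination (- (-m / v ^ 2 - 1 / 2)) * key

theorem aux_limtop (A B m : ℝ) :
    Tendsto (fun v => A * stdNormalCDF (m / v + v / 2) - B * stdNormalCDF (m / v - v / 2))
      atTop (𝓝 A) := by
  have hm : Tendsto (fun v : ℝ => m / v) atTop (𝓝 0) := tendsto_const_nhds.div_atTop tendsto_id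
  have hh : Tendsto (fun v : ℝ => v / 2) atTop atTop := tendsto_id.atTop_div_const (by norm_num)
  have h1 : Tendsto (fun v : ℝ => m / v + v / 2) atTop atTop := hm.add_atTop hh
  have h2 : Tendsto (fun v : ℝ => m / v - v / 2) atTop atBot := by
    simp only [sub_eq_add_neg]
    exact hm.add_atBot (tendsto_neg_atTop_atBot.comp hh)
  simpa using ((aux_top.comp h1).const_mul A).sub ((aux_bot.comp h2).const_mul B)

theorem aux_limzero (A B m : ℝ) (hB : 0 < B) (hAB : A = B * Real.exp m) :
    Tendsto (fun v => A * stdNormalCDF (m / v + v / 2) - B * stdNormalCDF (m / v - v / 2))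
      (𝓝[>] 0) (𝓝 (max (A - B) 0)) := by
  have hh : Tendsto (fun v : ℝ => v / 2) (𝓝[>] 0) (𝓝 0) := by
    have : Tendsto (fun v : ℝ => v / 2) (𝓝 0) (𝓝 (0 / 2)) := by
      apply Continuous.tendsto; fun_prop
    rw [zero_div] at this
    exact this.mono_left nhdsWithin_le_nhds
  have hh' : Tendsto (fun v : ℝ => -(v / 2)) (𝓝[>] 0) (𝓝 0) := by simpa using hh.neg
  have hinv : Tendsto (fun v : ℝ => v⁻¹) (𝓝[>] 0) atTop := tendsto_inv_nhdsGT_zero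
  rcases lt_trichotomy m 0 with h | h | h
  · have hm : Tendsto (fun v : ℝ => m / v) (𝓝[>] 0) atBot := by
      simp only [div_eq_mul_inv]; exact hinv.const_mul_atTop_of_neg h
    have h1 := hm.atBot_add hh
    have h2 := hm.atBot_add hh'
    have hle : A - B ≤ 0 := by
      have := Real.exp_lt_one_iff.2 h
      rw [hAB]; nlinarith
    rw [max_eq_right hle]
    simpa [sub_eq_add_neg] using ((aux_bot.comp h1).const_mul A).sub ((aux_bot.comp h2).const_mul B)
  · subst h
    have hAB' : A = B := by simpa using hAB
    subst hAB'
    have hc : Tendsto stdNormalCDF (𝓝 0) (𝓝 (stdNormalCDF 0)) := (aux_deriv 0).continuousAt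
    simpa using ((hc.comp hh).const_mul A).sub ((hc.comp hh').const_mul A)
  · have hm : Tendsto (fun v : ℝ => m / v) (𝓝[>] 0) atTop := by
      simp only [div_eq_mul_inv]; exact hinv.const_mul_atTop h
    have h1 := hm.atTop_add hh
    have h2 := hm.atTop_add hh'
    have hle : 0 ≤ A - B := by
      have := Real.one_lt_exp_iff.2 h
      rw [hAB]; nlinarith
    rw [max_eq_left hle]
    simpa [sub_eq_add_neg] using ((aux_top.comp h1).const_mul A).sub ((aux_top.comp h2).const_mul B)

theorem aux_main (A B m p : ℝ) (hB : 0 < B) (hAB : A = B * Real.exp m)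
    (hlow : max (A - B) 0 < p) (hhigh : p < A) :
    ∃! v : ℝ, 0 < v ∧
      A * stdNormalCDF (m / v + v / 2) - B * stdNormalCDF (m / v - v / 2) = p := by
  set f : ℝ → ℝ := fun v =>
    A * stdNormalCDF (m / v + v / 2) - B * stdNormalCDF (m / v - v / 2) with hf
  have hA : 0 < A := by rw [hAB]; positivity
  have hd : ∀ v, 0 < v → HasDerivAt f (A * stdNormalPDF (m / v + v / 2)) v :=
    fun v hv => aux_fderiv A B m v hv hAB
  have hcont : ContinuousOn f (Ioi 0) := fun v hv => (hd v hv).continuousAt.continuousWithinAt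
  have hmono : StrictMonoOn f (Ioi 0) := by
    apply strictMonoOn_of_deriv_pos (convex_Ioi 0) hcont
    intro v hv
    rw [interior_Ioi] at hv
    rw [(hd v hv).deriv, stdNormalPDF]
    positivity
  obtain ⟨a, ha1, ha⟩ := (((aux_limzero A B m hB hAB).eventually (gt_mem_nhds hlow)).and
    self_mem_nhdsWithin).exists
  obtain ⟨b, hb1, hb⟩ := (((aux_limtop A B m).eventually (lt_mem_nhds hhigh)).and
    (eventually_gt_atTop 0)).exists
  obtain ⟨v, hv, hvp⟩ := (isPreconnected_Ioi.intermediate_value ha (show b ∈ Ioi (0:ℝ) from hb) hcont)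
    (show p ∈ Icc (f a) (f b) from ⟨le_of_lt ha1, le_of_lt hb1⟩)
  exact ⟨v, ⟨hv, hvp⟩, fun w hw => hmono.injOn hw.1 hv (hw.2.trans hvp.symm)⟩

/-- Well-posedness of implied volatility: any price strictly inside the no-arbitrage
bounds is attained by the Black–Scholes formula at a unique positive volatility. -/
theorem stmt_8 (S K τ r δ price : ℝ) (hS : 0 < S) (hK : 0 < K) (hτ : 0 < τ)
    (hlow : max (S * Real.exp (-δ * τ) - K * Real.exp (-r * τ)) 0 < price)
    (hhigh : price < S * Real.exp (-δ * τ)) :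
    ∃! σ : ℝ, 0 < σ ∧ bsCall S σ r δ K τ = price := by
  have hAB : S * Real.exp (-δ * τ) = K * Real.exp (-r * τ) *
      Real.exp (Real.log (S / K) + (r - δ) * τ) := by
    rw [Real.exp_add, Real.exp_log (by positivity)]
    have : Real.exp (-δ * τ) = Real.exp (-r * τ) * Real.exp ((r - δ) * τ) := by
      rw [← Real.exp_add]; congr 1; ring
    rw [this]; field_simp
  have hs : 0 < Real.sqrt τ := Real.sqrt_pos.2 hτ
  obtain ⟨v, ⟨hv, hvp⟩, hu⟩ := aux_main _ _ _ price (by positivity) hAB hlow hhigh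
  refine ⟨v / Real.sqrt τ, ⟨by positivity, ?_⟩, ?_⟩
  · unfold bsCall dPlus dMinus
    rw [div_mul_cancel₀ _ hs.ne']
    exact hvp
  · rintro σ ⟨hσ, h⟩
    rw [eq_div_iff hs.ne']
    exact hu _ ⟨by positivity, h⟩
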